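/- The grid-to-nested-word encoding is a strong first-order reduction: the map Φ sending the (n,m)-grid to the nested word nested(aⁿ[(āb)ⁿ(b̄a)ⁿ]^{(m−1)/2} āⁿ) for odd m and nested(aⁿ[(āb)ⁿ(b̄a)ⁿ]^{m/2−1}(āb)ⁿ b̄ⁿ) for even m is injective, the universe of Φ(G(n,m)) is in natural bijection with two disjoint copies of [n]×[m] (call positions and their matching returns), the pairing formula ψ(x₁,x₂) = μ(x₁,x₂) identifies the two copies of each grid node, and there are first-order formulas over the grid signature defining the preimages of λ_a, λ_b, λ_ā, λ_b̄, ⋖, and μ, as well as first-order formulas over the nested-word signature defining the images of succ₁, succ₂, P_a, P_b (for instance succ₂(u₁,u₂) corresponds to ∃z (μ(x₁,z) ∧ z ⋖ x₂)). -/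

import Mathlib

/-- The *kind* of a letter in a `K`-stack call-return alphabet: a call of some
stack `s`, a return of some stack `s`, or an internal action. -/
inductive CRKind (K : ℕ) where
  | call (s : Fin K)
  | ret (s : Fin K)
  | int

/-- A `K`-stack call-return alphabet over the letters `A`: every letter is
(exclusively) a call of one stack, a return of one stack, or internal.  This
encodes the pairwise disjointness of the collection
`⟨{(Σ_c^s, Σ_r^s)}_{s∈[K]}, Σ_int⟩` together with `Σ` being their union. -/
structure CRAlphabet (K : ℕ) (A : Type) where
  kind : A → CRKind K

namespace CRAlphabet

variable {K : ℕ} {A : Type}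

def callSet (h : CRAlphabet K A) (s : Fin K) : Set A := {a | h.kind a = .call s}
def retSet (h : CRAlphabet K A) (s : Fin K) : Set A := {a | h.kind a = .ret s}
def intSet (h : CRAlphabet K A) : Set A := {a | h.kind a = .int}

end CRAlphabet

/-- `s`-well-formed strings: generated by the grammar
`A ::= aAb | AA | ε | c` with `a ∈ c`, `b ∈ r`, `c ∉ c ∪ r`. -/
inductive SWellFormed {A : Type} (c r : Set A) : List A → Prop where
  | nil : SWellFormed c r []
  | single {x : A} : x ∉ c → x ∉ r → SWellFormed c r [x]
  | wrap {a b : A} {u : List A} : a ∈ c → b ∈ r → SWellFormed c r u →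
      SWellFormed c r (a :: u ++ [b])
  | concat {u v : List A} : SWellFormed c r u → SWellFormed c r v →
      SWellFormed c r (u ++ v)

/-- The matching relation `μ^s` of the nested word determined by the string
`w` (positions `0`-based): `(i,j) ∈ μ^s` iff `i < j`, `λ(i) ∈ Σ_c^s`,
`λ(j) ∈ Σ_r^s` and `λ(i+1) … λ(j-1)` is `s`-well formed. -/
def Matched {K : ℕ} {A : Type} (h : CRAlphabet K A) (w : List A) (s : Fin K)
    (i j : ℕ) : Prop :=
  i < j ∧ j < w.length ∧
  (∃ a, w[i]? = some a ∧ a ∈ h.callSet s) ∧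
  (∃ b, w[j]? = some b ∧ b ∈ h.retSet s) ∧
  SWellFormed (h.callSet s) (h.retSet s) ((w.take j).drop (i + 1))

/-- The full matching relation `μ = ⋃_s μ^s`. -/
def MuAny {K : ℕ} {A : Type} (h : CRAlphabet K A) (w : List A) (i j : ℕ) : Prop :=
  ∃ s, Matched h w s i j

/-- The letters of the 2-stack call-return alphabet with `Σ_c^1 = {a}`,
`Σ_r^1 = {ā}`, `Σ_c^2 = {b}`, `Σ_r^2 = {b̄}`, `Σ_int = ∅`. -/
inductive L2 where
  | a | abar | b | bbar
deriving DecidableEq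

def h2 : CRAlphabet 2 L2 :=
  ⟨fun x => match x with
    | .a => .call 0 | .abar => .ret 0
    | .b => .call 1 | .bbar => .ret 1⟩

/-- MSO formulas over the signature `τ_Σ̃ = {λ_a | a ∈ Σ} ∪ {⋖, μ}` of nested
words (first-order variables and second-order variables are indexed by `ℕ`). -/
inductive MSO (A : Type) where
  | lab (a : A) (x : ℕ)
  | succ (x y : ℕ)
  | mu (x y : ℕ)
  | eq (x y : ℕ)
  | mem (x : ℕ) (X : ℕ)
  | not (φ : MSO A)
  | or (φ ψ : MSO A)
  | ex1 (x : ℕ) (φ : MSO A)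
  | ex2 (X : ℕ) (φ : MSO A)

/-- Satisfaction of an MSO formula in the nested word of `w`, under
first-order valuation `ν` and second-order valuation `μv`. -/
def Sat {K : ℕ} {A : Type} (h : CRAlphabet K A) (w : List A) :
    MSO A → (ℕ → ℕ) → (ℕ → Set ℕ) → Prop
  | .lab a x, ν, _ => w[(ν x)]? = some a
  | .succ x y, ν, _ => ν y = ν x + 1 ∧ ν y < w.length
  | .mu x y, ν, _ => MuAny h w (ν x) (ν y)
  | .eq x y, ν, _ => ν x = ν y
  | .mem x X, ν, μv => ν x ∈ μv X
  | .not φ, ν, μv => ¬ Sat h w φ ν μv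
  | .or φ ψ, ν, μv => Sat h w φ ν μv ∨ Sat h w ψ ν μv
  | .ex1 x φ, ν, μv => ∃ i < w.length, Sat h w φ (Function.update ν x i) μv
  | .ex2 X φ, ν, μv => ∃ S : Set ℕ, S ⊆ {i | i < w.length} ∧
      Sat h w φ ν (Function.update μv X S)

/-- First-order formulas: no second-order quantification. -/
def FirstOrder {A : Type} : MSO A → Prop
  | .not φ => FirstOrder φ
  | .or φ ψ => FirstOrder φ ∧ FirstOrder ψ
  | .ex1 _ φ => FirstOrder φ
  | .ex2 _ _ => False
  | _ => True

/-- Existential MSO formulas: a block of existential second-order quantifiers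
followed by a first-order formula. -/
inductive IsEMSO {A : Type} : MSO A → Prop where
  | fo {φ} : FirstOrder φ → IsEMSO φ
  | ex {X φ} : IsEMSO φ → IsEMSO (MSO.ex2 X φ)

/-- Semantic sentencehood: satisfaction does not depend on the valuations. -/
def ClosedOn {K : ℕ} {A : Type} (h : CRAlphabet K A) (φ : MSO A) : Prop :=
  ∀ w ν ν' μv μv', Sat h w φ ν μv ↔ Sat h w φ ν' μv'

/-- The set of nested words (nonempty strings) defined by a sentence. -/
def mLang {K : ℕ} {A : Type} (h : CRAlphabet K A) (φ : MSO A) : Set (List A) :=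
  {w | w ≠ [] ∧ Sat h w φ (fun _ => 0) (fun _ => ∅)}

/-- `k`-fold repetition of a word. -/
def pw (u : List L2) (k : ℕ) : List L2 := (List.replicate k u).flatten

/-- The encoding of the `(n,m)`-grid as a nested word:
`aⁿ[(āb)ⁿ(b̄a)ⁿ]^{(m−1)/2} āⁿ` for odd `m`, and
`aⁿ[(āb)ⁿ(b̄a)ⁿ]^{m/2−1}(āb)ⁿ b̄ⁿ` for even `m`. -/
def encodeGrid (n m : ℕ) : List L2 :=
  if m % 2 = 1 then
    pw [L2.a] n ++ pw (pw [L2.abar, L2.b] n ++ pw [L2.bbar, L2.a] n) ((m - 1) / 2)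
      ++ pw [L2.abar] n
  else
    pw [L2.a] n ++ pw (pw [L2.abar, L2.b] n ++ pw [L2.bbar, L2.a] n) (m / 2 - 1)
      ++ pw [L2.abar, L2.b] n ++ pw [L2.bbar] n

/-- First-order formulas over the grid signature
`τ_Grids = {P_a, P_b, succ₁, succ₂}` (variables indexed by `ℕ`). -/
inductive GF where
  | pa (x : ℕ)
  | pb (x : ℕ)
  | s1 (x y : ℕ)
  | s2 (x y : ℕ)
  | eq (x y : ℕ)
  | not (φ : GF)
  | or (φ ψ : GF)
  | ex (x : ℕ) (φ : GF)

/-- Satisfaction in the `(n,m)`-grid `G(n,m)` (nodes are pairs `(i,j)` with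
`i < n`, `j < m`, `0`-based; column `j` is labeled `a` iff `j` is even,
i.e. the `1`-based column index `j+1` is odd). -/
def GSat (n m : ℕ) : GF → (ℕ → ℕ × ℕ) → Prop
  | .pa x, ν => (ν x).2 % 2 = 0
  | .pb x, ν => (ν x).2 % 2 = 1
  | .s1 x y, ν => (ν y).1 = (ν x).1 + 1 ∧ (ν y).2 = (ν x).2 ∧ (ν y).1 < n
  | .s2 x y, ν => (ν y).2 = (ν x).2 + 1 ∧ (ν y).1 = (ν x).1 ∧ (ν y).2 < m
  | .eq x y, ν => ν x = ν y
  | .not φ, ν => ¬ GSat n m φ ν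
  | .or φ ψ, ν => GSat n m φ ν ∨ GSat n m ψ ν
  | .ex x φ, ν => ∃ p : ℕ × ℕ, p.1 < n ∧ p.2 < m ∧
      GSat n m φ (Function.update ν x p)

section WellFormed

variable {A : Type}

open Classical in
/-- The number of letters in `c` minus the number of letters in `r`. -/
noncomputable def balance (c r : Set A) (w : List A) : ℤ :=
  (w.map fun x => if x ∈ c then (1 : ℤ) else if x ∈ r then -1 else 0).sum

theorem balance_nil (c r : Set A) : balance c r [] = 0 := rfl

theorem balance_append (c r : Set A) (u v : List A) :
    balance c r (u ++ v) = balance c r u + balance c r v := by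
  simp [balance]

theorem balance_call {c r : Set A} {x : A} (hx : x ∈ c) : balance c r [x] = 1 := by
  simp [balance, hx]

theorem balance_ret {c r : Set A} (hcr : Disjoint c r) {x : A} (hx : x ∈ r) :
    balance c r [x] = -1 := by
  have hc : x ∉ c := fun h => Set.disjoint_left.mp hcr h hx
  simp [balance, hx, hc]

theorem balance_int {c r : Set A} {x : A} (hc : x ∉ c) (hr : x ∉ r) :
    balance c r [x] = 0 := by
  simp [balance, hc, hr]

theorem SWellFormed.balance_eq_zero {c r : Set A} (hcr : Disjoint c r) {w : List A}
    (h : SWellFormed c r w) : balance c r w = 0 := by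
  induction h with
  | nil => rfl
  | single hc hr => exact balance_int hc hr
  | @wrap a b u ha hb _ ih =>
    rw [← List.singleton_append, balance_append, balance_append, balance_call ha,
      balance_ret hcr hb, ih]
    norm_num
  | concat _ _ ih₁ ih₂ => rw [balance_append, ih₁, ih₂, add_zero]

theorem SWellFormed.balance_prefix_nonneg {c r : Set A} (hcr : Disjoint c r) {w : List A}
    (h : SWellFormed c r w) : ∀ p, p <+: w → 0 ≤ balance c r p := by
  induction h with
  | nil =>
    intro p hp
    rw [List.prefix_nil.mp hp, balance_nil]
  | single hc hr =>
    intro p hp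
    rcases List.prefix_cons_iff.mp hp with rfl | ⟨t, rfl, ht⟩
    · rw [balance_nil]
    · rw [List.prefix_nil.mp ht, balance_int hc hr]
  | @wrap a b u ha hb hu ih =>
    intro p hp
    rcases List.prefix_concat_iff.mp hp with rfl | hp
    · exact ((SWellFormed.wrap ha hb hu).balance_eq_zero hcr).ge
    · rcases List.prefix_cons_iff.mp hp with rfl | ⟨t, rfl, ht⟩
      · rw [balance_nil]
      · rw [← List.singleton_append, balance_append, balance_call ha]
        have := ih t ht
        omega
  | @concat u v hu hv ih₁ ih₂ =>
    intro p hp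
    have huv := List.prefix_append u v
    rcases le_total p.length u.length with hle | hle
    · exact ih₁ p (List.prefix_of_prefix_length_le hp huv hle)
    · obtain ⟨t, rfl⟩ := List.prefix_of_prefix_length_le huv hp hle
      rw [balance_append, hu.balance_eq_zero hcr, zero_add]
      exact ih₂ t ((List.prefix_append_right_inj u).mp hp)

theorem CRAlphabet.disjoint_callSet_retSet {K : ℕ} (h : CRAlphabet K A) (s : Fin K) :
    Disjoint (h.callSet s) (h.retSet s) := by
  rw [Set.disjoint_left]
  intro x hc hr
  simp only [CRAlphabet.callSet, CRAlphabet.retSet, Set.mem_ofPred_eq] at hc hr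
  simp [hc] at hr

theorem Matched.not_lt {K : ℕ} {h : CRAlphabet K A} {w : List A} {s : Fin K} {i j j' : ℕ}
    (hj : Matched h w s i j) (hj' : Matched h w s i j') : ¬ j < j' := by
  intro hlt
  obtain ⟨hij, -, -, ⟨b, hb, hbr⟩, hwf⟩ := hj
  obtain ⟨-, -, -, -, hwf'⟩ := hj'
  have hcr := h.disjoint_callSet_retSet s
  have hsplit : (w.take (j + 1)).drop (i + 1) = (w.take j).drop (i + 1) ++ [b] := by
    obtain ⟨hjw, -⟩ := List.getElem?_eq_some_iff.mp hb
    rw [List.take_add_one, hb, Option.toList_some, List.drop_append_of_le_length]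
    rw [List.length_take]
    omega
  have hpre : (w.take (j + 1)).drop (i + 1) <+: (w.take j').drop (i + 1) :=
    (List.take_prefix_take_left (by omega)).drop _
  have := hwf'.balance_prefix_nonneg hcr _ hpre
  rw [hsplit, balance_append, hwf.balance_eq_zero hcr, balance_ret hcr hbr] at this
  omega

theorem MuAny.unique {K : ℕ} {h : CRAlphabet K A} {w : List A} {i j j' : ℕ}
    (hj : MuAny h w i j) (hj' : MuAny h w i j') : j = j' := by
  obtain ⟨s, hs⟩ := hj
  obtain ⟨s', hs'⟩ := hj'
  have hss : s = s' := by
    obtain ⟨-, -, ⟨x, hx, hxc⟩, -⟩ := hs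
    obtain ⟨-, -, ⟨y, hy, hyc⟩, -⟩ := hs'
    obtain rfl : x = y := Option.some.inj (hx.symm.trans hy)
    simp only [CRAlphabet.callSet, Set.mem_ofPred_eq] at hxc hyc
    simpa [hxc] using hyc
  subst hss
  have h₁ := hs.not_lt hs'
  have h₂ := hs'.not_lt hs
  omega

theorem matched_append {K : ℕ} (h : CRAlphabet K A) {s : Fin K} (P Q : List A) {W : List A}
    {x y : A} (hx : x ∈ h.callSet s) (hy : y ∈ h.retSet s)
    (hW : SWellFormed (h.callSet s) (h.retSet s) W) :
    Matched h (P ++ x :: (W ++ y :: Q)) s P.length (P.length + 1 + W.length) := by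
  refine ⟨by omega, by simp; omega, ⟨x, by simp, hx⟩, ⟨y, ?_, hy⟩, ?_⟩
  · rw [List.getElem?_append_right (by omega)]
    simp [show P.length + 1 + W.length - P.length = W.length + 1 by omega]
  · have : P ++ x :: (W ++ y :: Q) = (P ++ [x]) ++ W ++ (y :: Q) := by simp
    rw [this, List.take_left' (by simp; omega), List.drop_left' (by simp)]
    exact hW

end WellFormed

section Words

theorem pw_zero (u : List L2) : pw u 0 = [] := rfl

theorem pw_add (u : List L2) (k l : ℕ) : pw u (k + l) = pw u k ++ pw u l := by
  rw [pw, List.replicate_add, List.flatten_append, pw, pw]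

theorem pw_one (u : List L2) : pw u 1 = u := by simp [pw]

theorem length_pw (u : List L2) (k : ℕ) : (pw u k).length = k * u.length := by
  simp [pw]

theorem pw_add_one_left (u : List L2) (k : ℕ) : pw u (k + 1) = u ++ pw u k := by
  rw [add_comm, pw_add, pw_one]

theorem pw_add_one_right (u : List L2) (k : ℕ) : pw u (k + 1) = pw u k ++ u := by
  rw [pw_add, pw_one]

theorem sWellFormed_pw_append_pw {c r : Set L2} {x y : L2} {X Y : List L2}
    (hx : x ∈ c) (hy : y ∈ r) (hX : SWellFormed c r X) (hY : SWellFormed c r Y) (t : ℕ) :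
    SWellFormed c r (pw (X ++ [x]) t ++ pw (y :: Y) t) := by
  induction t with
  | zero => exact .nil
  | succ t ih =>
    have := SWellFormed.concat (SWellFormed.concat hX (SWellFormed.wrap hx hy ih)) hY
    rw [pw_add_one_left, pw_add_one_right]
    simpa using this

end Words

section Encoding

/-- The call letter of column `j`. -/
def callLetter (j : ℕ) : L2 := if j % 2 = 0 then .a else .b

/-- The return letter of column `j`. -/
def retLetter (j : ℕ) : L2 := if j % 2 = 0 then .abar else .bbar

/-- The stack used by column `j`. -/
def colStack (j : ℕ) : Fin 2 := if j % 2 = 0 then 0 else 1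

theorem kind_callLetter (j : ℕ) : h2.kind (callLetter j) = .call (colStack j) := by
  unfold callLetter colStack
  split_ifs <;> rfl

theorem kind_retLetter (j : ℕ) : h2.kind (retLetter j) = .ret (colStack j) := by
  unfold retLetter colStack
  split_ifs <;> rfl

theorem colStack_succ_ne (j : ℕ) : colStack (j + 1) ≠ colStack j := by
  unfold colStack
  split_ifs <;> omega

/-- What precedes each call of column `j`. -/
def beforeCall : ℕ → List L2
  | 0 => []
  | j + 1 => [retLetter j]

/-- What follows each return of column `j` in the encoding of a grid with `m` columns. -/
def afterRet (m j : ℕ) : List L2 := if j + 1 < m then [callLetter (j + 1)] else []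

theorem sWellFormed_beforeCall (j : ℕ) :
    SWellFormed (h2.callSet (colStack j)) (h2.retSet (colStack j)) (beforeCall j) := by
  cases j with
  | zero => exact .nil
  | succ j =>
    apply SWellFormed.single
    · simp [CRAlphabet.callSet, kind_retLetter]
    · simp [CRAlphabet.retSet, kind_retLetter, (colStack_succ_ne j).symm]

theorem sWellFormed_afterRet (m j : ℕ) :
    SWellFormed (h2.callSet (colStack j)) (h2.retSet (colStack j)) (afterRet m j) := by
  unfold afterRet
  split_ifs
  · apply SWellFormed.single
    · simp [CRAlphabet.callSet, kind_callLetter, colStack_succ_ne j]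
    · simp [CRAlphabet.retSet, kind_callLetter]
  · exact .nil

/-- The part of the encoding that ends with the last call of column `j`. -/
def encodePrefix (n : ℕ) : ℕ → List L2
  | 0 => pw [.a] n
  | j + 1 => encodePrefix n j ++ pw [retLetter j, callLetter (j + 1)] n

/-- The position after the last call of column `j`. -/
def colEnd (n j : ℕ) : ℕ := n + 2 * n * j

theorem colEnd_zero (n : ℕ) : colEnd n 0 = n := rfl

theorem colEnd_succ (n j : ℕ) : colEnd n (j + 1) = colEnd n j + 2 * n := by
  simp only [colEnd]
  ring

theorem colEnd_add_le {n j j' : ℕ} (h : j < j') : colEnd n j + 2 * n ≤ colEnd n j' := by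
  rw [← colEnd_succ]
  unfold colEnd
  gcongr
  exact h

theorem length_encodePrefix (n j : ℕ) : (encodePrefix n j).length = colEnd n j := by
  induction j with
  | zero => simp [encodePrefix, length_pw, colEnd_zero]
  | succ j ih =>
    simp only [encodePrefix, List.length_append, ih, length_pw, colEnd_succ, List.length_cons,
      List.length_nil]
    omega

theorem encodePrefix_two_mul (n q : ℕ) : encodePrefix n (2 * q) =
    pw [.a] n ++ pw (pw [.abar, .b] n ++ pw [.bbar, .a] n) q := by
  induction q with
  | zero => simp [encodePrefix, pw_zero]
  | succ q ih =>
    rw [pw_add_one_right, show 2 * (q + 1) = 2 * q + 1 + 1 by ring]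
    simp only [encodePrefix, ih]
    simp [callLetter, retLetter, Nat.add_mod]

theorem encodeGrid_succ (n m : ℕ) :
    encodeGrid n (m + 1) = encodePrefix n m ++ pw [retLetter m] n := by
  rcases Nat.even_or_odd' m with ⟨q, rfl | rfl⟩
  · rw [encodeGrid, if_pos (by omega), show (2 * q + 1 - 1) / 2 = q by omega,
      encodePrefix_two_mul]
    simp [retLetter]
  · rw [encodeGrid, if_neg (by omega), show (2 * q + 1 + 1) / 2 - 1 = q by omega]
    simp only [encodePrefix, encodePrefix_two_mul]
    simp [callLetter, retLetter, Nat.add_mod]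

theorem length_encodeGrid {m : ℕ} (n : ℕ) (hm : 0 < m) : (encodeGrid n m).length = 2 * n * m := by
  obtain ⟨m, rfl⟩ : ∃ k, m = k + 1 := ⟨m - 1, by omega⟩
  rw [encodeGrid_succ, List.length_append, length_encodePrefix, length_pw, colEnd]
  simp
  ring

theorem encodePrefix_mono {n j j' : ℕ} (h : j ≤ j') :
    encodePrefix n j <+: encodePrefix n j' := by
  induction h with
  | refl => exact List.prefix_refl _
  | step _ ih => exact ih.trans (List.prefix_append _ _)

theorem exists_encodeGrid_eq_append {n m j : ℕ} (hj : j < m) : ∃ Q,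
    encodeGrid n m = encodePrefix n j ++ (pw (retLetter j :: afterRet m j) n ++ Q) := by
  obtain ⟨m, rfl⟩ : ∃ k, m = k + 1 := ⟨m - 1, by omega⟩
  rw [encodeGrid_succ]
  unfold afterRet
  split_ifs with h
  · obtain ⟨Q, hQ⟩ := encodePrefix_mono (n := n) (show j + 1 ≤ m by omega)
    refine ⟨Q ++ pw [retLetter m] n, ?_⟩
    rw [← hQ]
    simp [encodePrefix]
  · obtain rfl : j = m := by omega
    exact ⟨[], by simp⟩

/-- The position of the `k`-th call of column `j`. -/
def callPos (n : ℕ) : ℕ → ℕ → ℕ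
  | 0, k => k
  | j + 1, k => colEnd n j + 2 * k + 1

/-- The position of the return matching the `k`-th call of column `j`. -/
def retPos (n m j k : ℕ) : ℕ :=
  colEnd n j + if j + 1 < m then 2 * (n - 1 - k) else n - 1 - k

theorem exists_encodePrefix_eq {n j k : ℕ} (hk : k < n) : ∃ P, P.length = callPos n j k ∧
    encodePrefix n j = P ++ callLetter j :: pw (beforeCall j ++ [callLetter j]) (n - 1 - k) := by
  have hn : n = k + 1 + (n - 1 - k) := by omega
  cases j with
  | zero =>
    refine ⟨pw [.a] k, by simp [length_pw, callPos], ?_⟩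
    rw [encodePrefix]
    conv_lhs => rw [hn, pw_add, pw_add_one_right]
    simp [callLetter, beforeCall]
  | succ j =>
    refine ⟨encodePrefix n j ++ (pw [retLetter j, callLetter (j + 1)] k ++ [retLetter j]), ?_, ?_⟩
    · simp [length_pw, length_encodePrefix, callPos]
      omega
    · rw [encodePrefix]
      conv_lhs => enter [2]; rw [hn, pw_add, pw_add_one_right]
      simp [beforeCall]

theorem exists_encodeGrid_eq {n m j k : ℕ} (hj : j < m) (hk : k < n) : ∃ P W Q,
    encodeGrid n m = P ++ callLetter j :: (W ++ retLetter j :: Q) ∧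
    P.length = callPos n j k ∧ P.length + 1 + W.length = retPos n m j k ∧
    SWellFormed (h2.callSet (colStack j)) (h2.retSet (colStack j)) W := by
  obtain ⟨Q, hQ⟩ := exists_encodeGrid_eq_append (n := n) hj
  obtain ⟨P, hP, hpre⟩ := exists_encodePrefix_eq (j := j) hk
  refine ⟨P, pw (beforeCall j ++ [callLetter j]) (n - 1 - k) ++
    pw (retLetter j :: afterRet m j) (n - 1 - k),
    afterRet m j ++ pw (retLetter j :: afterRet m j) k ++ Q, ?_, hP, ?_, ?_⟩
  · have hn : n = (n - 1 - k) + (k + 1) := by omega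
    rw [hQ, hpre]
    conv_lhs => enter [2, 1]; rw [hn, pw_add, pw_add_one_left]
    simp
  · have := congrArg List.length hpre
    rw [length_encodePrefix, List.length_append, List.length_cons] at this
    rw [List.length_append, retPos, this, length_pw _ (n - 1 - k), length_pw]
    unfold afterRet
    split_ifs <;> simp <;> ring
  · exact sWellFormed_pw_append_pw (kind_callLetter j) (kind_retLetter j)
      (sWellFormed_beforeCall j) (sWellFormed_afterRet m j) _

theorem getElem?_callPos {n m j k : ℕ} (hj : j < m) (hk : k < n) :
    (encodeGrid n m)[callPos n j k]? = some (callLetter j) := by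
  obtain ⟨P, W, Q, h, hP, -, -⟩ := exists_encodeGrid_eq hj hk
  rw [h, ← hP]
  simp

theorem getElem?_retPos {n m j k : ℕ} (hj : j < m) (hk : k < n) :
    (encodeGrid n m)[retPos n m j k]? = some (retLetter j) := by
  obtain ⟨P, W, Q, h, hP, hW, -⟩ := exists_encodeGrid_eq hj hk
  rw [h, ← hW, List.getElem?_append_right (by omega)]
  simp [show P.length + 1 + W.length - P.length = W.length + 1 by omega]

theorem muAny_callPos_retPos {n m j k : ℕ} (hj : j < m) (hk : k < n) :
    MuAny h2 (encodeGrid n m) (callPos n j k) (retPos n m j k) := by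
  obtain ⟨P, W, Q, h, hP, hW, hwf⟩ := exists_encodeGrid_eq hj hk
  rw [h, ← hW, ← hP]
  exact ⟨_, matched_append h2 P Q (kind_callLetter j) (kind_retLetter j) hwf⟩

theorem callPos_lt_colEnd {n j k : ℕ} (hk : k < n) : callPos n j k < colEnd n j := by
  cases j with
  | zero => simpa [callPos, colEnd_zero] using hk
  | succ j =>
    rw [callPos, colEnd_succ]
    omega

theorem colEnd_lt_callPos {n j j' k : ℕ} (h : j < j') : colEnd n j < callPos n j' k := by
  cases j' with
  | zero => omega
  | succ j' =>
    rw [callPos]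
    rcases (Nat.lt_succ_iff.mp h).eq_or_lt with rfl | h
    · omega
    · have := colEnd_add_le (n := n) h
      omega

theorem colEnd_le_retPos (n m j k : ℕ) : colEnd n j ≤ retPos n m j k := Nat.le_add_right _ _

theorem retPos_add_one_lt {n m j k : ℕ} (hk : k < n) :
    retPos n m j k + 1 < colEnd n j + 2 * n := by
  unfold retPos
  split_ifs <;> omega

theorem callPos_inj {n j j' k k' : ℕ} (hk : k < n) (hk' : k' < n)
    (h : callPos n j k = callPos n j' k') : j = j' ∧ k = k' := by
  have hjj : j = j' := by
    have h₁ := callPos_lt_colEnd (j := j) hk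
    have h₂ := callPos_lt_colEnd (j := j') hk'
    rcases lt_trichotomy j j' with hlt | heq | hlt
    · have := colEnd_lt_callPos (n := n) (k := k') hlt
      omega
    · exact heq
    · have := colEnd_lt_callPos (n := n) (k := k) hlt
      omega
  subst hjj
  cases j <;> simp only [callPos] at h <;> omega

theorem retPos_inj {n m j j' k k' : ℕ} (hk : k < n) (hk' : k' < n)
    (h : retPos n m j k = retPos n m j' k') : j = j' ∧ k = k' := by
  have hjj : j = j' := by
    have h₁ := retPos_add_one_lt (m := m) (j := j) hk
    have h₂ := retPos_add_one_lt (m := m) (j := j') hk'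
    have h₃ := colEnd_le_retPos n m j k
    have h₄ := colEnd_le_retPos n m j' k'
    rcases lt_trichotomy j j' with hlt | heq | hlt
    · have := colEnd_add_le (n := n) hlt
      omega
    · exact heq
    · have := colEnd_add_le (n := n) hlt
      omega
  subst hjj
  unfold retPos at h
  split_ifs at h <;> omega

theorem callPos_ne_retPos {n m j j' k k' : ℕ} (hj : j < m) (hj' : j' < m) (hk : k < n)
    (hk' : k' < n) : callPos n j k ≠ retPos n m j' k' := by
  intro h
  have h₁ := getElem?_callPos hj hk
  rw [h, getElem?_retPos hj' hk', Option.some_inj] at h₁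
  have h₂ := congrArg h2.kind h₁
  simp [kind_callLetter, kind_retLetter] at h₂

theorem callPos_eq_callPos_add_one_iff {n j₁ j₂ k₁ k₂ : ℕ} (hk₁ : k₁ < n) (hk₂ : k₂ < n) :
    callPos n j₂ k₂ = callPos n j₁ k₁ + 1 ↔ j₁ = 0 ∧ j₂ = 0 ∧ k₂ = k₁ + 1 := by
  constructor
  · intro h
    have h₁ := callPos_lt_colEnd (j := j₁) hk₁
    have h₂ := callPos_lt_colEnd (j := j₂) hk₂
    rcases lt_trichotomy j₁ j₂ with hlt | rfl | hlt
    · have := colEnd_lt_callPos (n := n) (k := k₂) hlt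
      omega
    · cases j₁ <;> simp only [callPos] at h <;> omega
    · have := colEnd_lt_callPos (n := n) (k := k₁) hlt
      omega
  · rintro ⟨rfl, rfl, rfl⟩
    rfl

theorem callPos_eq_retPos_add_one_iff {n m j₁ j₂ k₁ k₂ : ℕ} (hj₂ : j₂ < m)
    (hk₁ : k₁ < n) (hk₂ : k₂ < n) :
    callPos n j₂ k₂ = retPos n m j₁ k₁ + 1 ↔ j₂ = j₁ + 1 ∧ k₁ + k₂ + 1 = n := by
  have key : ∀ j, j + 1 < m →
      (callPos n (j + 1) k₂ = retPos n m j k₁ + 1 ↔ k₁ + k₂ + 1 = n) := by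
    intro j hj
    simp only [callPos, retPos, if_pos hj]
    omega
  constructor
  · intro h
    have h₁ := retPos_add_one_lt (m := m) (j := j₁) hk₁
    have h₃ := colEnd_le_retPos n m j₁ k₁
    have h₂ := callPos_lt_colEnd (j := j₂) hk₂
    have hj : j₂ = j₁ + 1 := by
      rcases lt_trichotomy j₂ (j₁ + 1) with hlt | rfl | hlt
      · rcases (Nat.lt_succ_iff.mp hlt).eq_or_lt with rfl | hlt
        · omega
        · have := colEnd_add_le (n := n) hlt
          omega
      · rfl
      · have := colEnd_lt_callPos (n := n) (k := k₂) hlt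
        rw [colEnd_succ] at this
        omega
    subst hj
    exact ⟨rfl, (key j₁ hj₂).mp h⟩
  · rintro ⟨rfl, h⟩
    exact (key j₁ hj₂).mpr h

theorem retPos_eq_callPos_add_one_iff {n m j₁ j₂ k₁ k₂ : ℕ} (hj₁ : j₁ < m)
    (hk₁ : k₁ < n) (hk₂ : k₂ < n) :
    retPos n m j₂ k₂ = callPos n j₁ k₁ + 1 ↔
      (j₂ = j₁ ∧ k₁ + 1 = n ∧ k₂ + 1 = n) ∨ (j₁ = j₂ + 1 ∧ k₁ + k₂ + 2 = n) := by
  constructor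
  · intro h
    have h₁ := retPos_add_one_lt (m := m) (j := j₂) hk₂
    have h₃ := colEnd_le_retPos n m j₂ k₂
    have h₂ := callPos_lt_colEnd (j := j₁) hk₁
    rcases lt_trichotomy j₁ (j₂ + 1) with hlt | rfl | hlt
    · rcases (Nat.lt_succ_iff.mp hlt).eq_or_lt with rfl | hlt
      · left
        cases j₁ with
        | zero =>
          simp only [callPos, retPos, colEnd_zero] at h
          split_ifs at h <;> omega
        | succ j =>
          simp only [callPos, retPos, colEnd_succ] at h
          split_ifs at h <;> omega
      · have := colEnd_add_le (n := n) hlt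
        omega
    · right
      simp only [callPos, retPos, if_pos hj₁] at h
      omega
    · have := colEnd_lt_callPos (n := n) (k := k₁) hlt
      rw [colEnd_succ] at this
      omega
  · rintro (⟨rfl, h₁, h₂⟩ | ⟨rfl, h⟩)
    · cases j₂ with
      | zero =>
        simp only [callPos, retPos, colEnd_zero]
        split_ifs <;> omega
      | succ j =>
        simp only [callPos, retPos, colEnd_succ]
        split_ifs <;> omega
    · simp only [callPos, retPos, if_pos hj₁]
      omega

theorem retPos_eq_retPos_add_one_iff {n m j₁ j₂ k₁ k₂ : ℕ} (hj₁ : j₁ < m) (hj₂ : j₂ < m)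
    (hk₁ : k₁ < n) (hk₂ : k₂ < n) :
    retPos n m j₂ k₂ = retPos n m j₁ k₁ + 1 ↔ j₁ + 1 = m ∧ j₂ + 1 = m ∧ k₁ = k₂ + 1 := by
  constructor
  · intro h
    have h₁ := retPos_add_one_lt (m := m) (j := j₁) hk₁
    have h₂ := retPos_add_one_lt (m := m) (j := j₂) hk₂
    have h₃ := colEnd_le_retPos n m j₁ k₁
    have h₄ := colEnd_le_retPos n m j₂ k₂
    rcases lt_trichotomy j₁ j₂ with hlt | rfl | hlt
    · have := colEnd_add_le (n := n) hlt
      omega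
    · unfold retPos at h
      split_ifs at h <;> omega
    · have := colEnd_add_le (n := n) hlt
      omega
  · rintro ⟨h₁, h₂, rfl⟩
    obtain rfl : j₁ = j₂ := by omega
    simp only [retPos, if_neg (show ¬ j₁ + 1 < m by omega)]
    omega

theorem callPos_eq_callPos_add_two_iff {n j₁ j₂ k₁ k₂ : ℕ} (hj : j₁ % 2 = j₂ % 2)
    (hk₁ : k₁ < n) (hk₂ : k₂ < n) :
    callPos n j₂ k₂ = callPos n j₁ k₁ + 2 ↔
      j₁ = j₂ ∧ (j₁ = 0 ∧ k₂ = k₁ + 2 ∨ j₁ ≠ 0 ∧ k₂ = k₁ + 1) := by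
  constructor
  · intro h
    have h₁ := callPos_lt_colEnd (j := j₁) hk₁
    have h₂ := callPos_lt_colEnd (j := j₂) hk₂
    rcases lt_trichotomy j₁ j₂ with hlt | rfl | hlt
    · have h₃ := colEnd_add_le (n := n) (Nat.lt_add_one j₁)
      have := colEnd_lt_callPos (n := n) (k := k₂) (show j₁ + 1 < j₂ by omega)
      omega
    · cases j₁ <;> simp only [callPos] at h <;> omega
    · have := colEnd_lt_callPos (n := n) (k := k₁) hlt
      omega
  · rintro ⟨rfl, ⟨rfl, rfl⟩ | ⟨h, rfl⟩⟩
    · rfl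
    · cases j₁ with
      | zero => exact absurd rfl h
      | succ j => simp only [callPos]; omega

theorem encodeGrid_injective {n m n' m' : ℕ} (hn : 0 < n) (hm : 0 < m) (hn' : 0 < n')
    (hm' : 0 < m') (h : encodeGrid n m = encodeGrid n' m') : n = n' ∧ m = m' := by
  have aux : ∀ {n m n' m' : ℕ}, 0 < n → 0 < m → 0 < m' →
      encodeGrid n m = encodeGrid n' m' → ¬ n < n' := by
    intro n m n' m' hn hm hm' h hlt
    have h₁ := getElem?_retPos (n := n) hm (show n - 1 < n by omega)
    have h₂ := getElem?_callPos (n := n') hm' hlt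
    have hpos : retPos n m 0 (n - 1) = callPos n' 0 n := by
      simp [retPos, callPos, colEnd_zero]
    rw [h, hpos, h₂] at h₁
    simp [callLetter, retLetter] at h₁
  obtain rfl : n = n' :=
    le_antisymm (not_lt.mp (aux hn' hm' hm h.symm)) (not_lt.mp (aux hn hm hm' h))
  have hlen := congrArg List.length h
  rw [length_encodeGrid n hm, length_encodeGrid n hm'] at hlen
  exact ⟨rfl, Nat.eq_of_mul_eq_mul_left (by omega) hlen⟩

end Encoding

section Positions

/-- The rank of a grid node within its column, in the order in which the encoding lists the
calls of that column. -/
def colRank (n : ℕ) (u : ℕ × ℕ) : ℕ := if u.2 % 2 = 0 then u.1 else n - 1 - u.1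

/-- The position of the call (`false`) or return (`true`) representing a grid node. -/
def nodePos (n m : ℕ) (κ : Bool) (u : ℕ × ℕ) : ℕ :=
  if κ then retPos n m u.2 (colRank n u) else callPos n u.2 (colRank n u)

/-- The letter at the call (`false`) or return (`true`) position of a node of column `j`. -/
def nodeLetter (κ : Bool) (j : ℕ) : L2 := if κ then retLetter j else callLetter j

theorem nodePos_false (n m : ℕ) (u : ℕ × ℕ) :
    nodePos n m false u = callPos n u.2 (colRank n u) := rfl

theorem nodePos_true (n m : ℕ) (u : ℕ × ℕ) :
    nodePos n m true u = retPos n m u.2 (colRank n u) := rfl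

variable {n m : ℕ} {u u₁ u₂ : ℕ × ℕ}

theorem colRank_lt (h : u.1 < n) : colRank n u < n := by
  unfold colRank
  split_ifs <;> omega

theorem eq_of_colRank_eq (h₁ : u₁.1 < n) (h₂ : u₂.1 < n) (hc : u₁.2 = u₂.2)
    (h : colRank n u₁ = colRank n u₂) : u₁ = u₂ := by
  refine Prod.ext ?_ hc
  unfold colRank at h
  rw [hc] at h
  split_ifs at h <;> omega

theorem getElem?_nodePos (κ : Bool) (h₁ : u.1 < n) (h₂ : u.2 < m) :
    (encodeGrid n m)[nodePos n m κ u]? = some (nodeLetter κ u.2) := by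
  cases κ
  · exact getElem?_callPos h₂ (colRank_lt h₁)
  · exact getElem?_retPos h₂ (colRank_lt h₁)

theorem nodePos_lt (κ : Bool) (h₁ : u.1 < n) (h₂ : u.2 < m) :
    nodePos n m κ u < (encodeGrid n m).length :=
  (List.getElem?_eq_some_iff.mp (getElem?_nodePos κ h₁ h₂)).1

theorem nodePos_inj {κ₁ κ₂ : Bool} (h₁ : u₁.1 < n) (h₂ : u₁.2 < m) (h₃ : u₂.1 < n)
    (h₄ : u₂.2 < m) (h : nodePos n m κ₁ u₁ = nodePos n m κ₂ u₂) : κ₁ = κ₂ ∧ u₁ = u₂ := by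
  have hr₁ := colRank_lt h₁
  have hr₂ := colRank_lt h₃
  cases κ₁ <;> cases κ₂
  · obtain ⟨hj, hk⟩ := callPos_inj hr₁ hr₂ h
    exact ⟨rfl, eq_of_colRank_eq h₁ h₃ hj hk⟩
  · exact absurd h (callPos_ne_retPos h₂ h₄ hr₁ hr₂)
  · exact absurd h.symm (callPos_ne_retPos h₄ h₂ hr₂ hr₁)
  · obtain ⟨hj, hk⟩ := retPos_inj hr₁ hr₂ h
    exact ⟨rfl, eq_of_colRank_eq h₁ h₃ hj hk⟩

theorem bijOn_nodePos (n : ℕ) (hm : 0 < m) :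
    Set.BijOn (fun p : Bool × (ℕ × ℕ) => nodePos n m p.1 p.2)
      ((Set.univ : Set Bool) ×ˢ (Set.Iio n ×ˢ Set.Iio m))
      (Set.Iio (encodeGrid n m).length) := by
  have hmaps : Set.MapsTo (fun p : Bool × (ℕ × ℕ) => nodePos n m p.1 p.2)
      ((Set.univ : Set Bool) ×ˢ (Set.Iio n ×ˢ Set.Iio m))
      (Set.Iio (encodeGrid n m).length) :=
    fun p hp => nodePos_lt p.1 hp.2.1 hp.2.2
  have hinj : Set.InjOn (fun p : Bool × (ℕ × ℕ) => nodePos n m p.1 p.2)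
      ((Set.univ : Set Bool) ×ˢ (Set.Iio n ×ˢ Set.Iio m)) := by
    intro p hp q hq h
    obtain ⟨h₁, h₂⟩ := nodePos_inj hp.2.1 hp.2.2 hq.2.1 hq.2.2 h
    exact Prod.ext h₁ h₂
  have hcard : ∀ k : ℕ, (Set.Iio k).ncard = k := fun k => by
    rw [← Finset.coe_Iio, Set.ncard_coe_finset, Nat.card_Iio]
  have himage := Set.eq_of_subset_of_ncard_le hmaps.image_subset (by
    rw [hinj.ncard_image, Set.ncard_prod, Set.ncard_prod, hcard, hcard, hcard, Set.ncard_univ,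
      length_encodeGrid n hm, Nat.card_eq_fintype_card, Fintype.card_bool, mul_assoc])
    (Set.finite_Iio _)
  rw [← himage]
  exact hinj.bijOn_image

theorem muAny_nodePos_iff {κ₁ κ₂ : Bool} (h₁ : u₁.1 < n) (h₂ : u₁.2 < m) (h₃ : u₂.1 < n)
    (h₄ : u₂.2 < m) :
    MuAny h2 (encodeGrid n m) (nodePos n m κ₁ u₁) (nodePos n m κ₂ u₂) ↔
      κ₁ = false ∧ κ₂ = true ∧ u₁ = u₂ := by
  constructor
  · intro h
    obtain rfl : κ₁ = false := by
      obtain ⟨s, -, -, ⟨x, hx, hxc⟩, -⟩ := h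
      rw [getElem?_nodePos κ₁ h₁ h₂, Option.some_inj] at hx
      subst hx
      cases κ₁
      · rfl
      · simp [nodeLetter, CRAlphabet.callSet, kind_retLetter] at hxc
    have := nodePos_inj (κ₁ := true) h₁ h₂ h₃ h₄
      (MuAny.unique (muAny_callPos_retPos h₂ (colRank_lt h₁)) h)
    exact ⟨rfl, this.1.symm, this.2⟩
  · rintro ⟨rfl, rfl, rfl⟩
    exact muAny_callPos_retPos h₂ (colRank_lt h₁)

theorem nodePos_call_call_succ_iff (h₁ : u₁.1 < n) (h₃ : u₂.1 < n) :
    nodePos n m false u₂ = nodePos n m false u₁ + 1 ↔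
      u₁.2 = 0 ∧ u₂.2 = 0 ∧ u₂.1 = u₁.1 + 1 := by
  rw [nodePos_false, nodePos_false,
    callPos_eq_callPos_add_one_iff (colRank_lt h₁) (colRank_lt h₃)]
  unfold colRank
  split_ifs <;> omega

theorem nodePos_ret_call_succ_iff (h₁ : u₁.1 < n) (h₃ : u₂.1 < n) (h₄ : u₂.2 < m) :
    nodePos n m false u₂ = nodePos n m true u₁ + 1 ↔ u₂.2 = u₁.2 + 1 ∧ u₂.1 = u₁.1 := by
  rw [nodePos_false, nodePos_true,
    callPos_eq_retPos_add_one_iff h₄ (colRank_lt h₁) (colRank_lt h₃)]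
  unfold colRank
  split_ifs <;> omega

theorem nodePos_call_ret_succ_iff (h₁ : u₁.1 < n) (h₂ : u₁.2 < m) (h₃ : u₂.1 < n) :
    nodePos n m true u₂ = nodePos n m false u₁ + 1 ↔
      (u₁ = u₂ ∧ (u₁.2 % 2 = 0 ∧ u₁.1 + 1 = n ∨ u₁.2 % 2 = 1 ∧ u₁.1 = 0)) ∨
      (u₁.2 = u₂.2 + 1 ∧
        (u₁.2 % 2 = 0 ∧ u₂.1 = u₁.1 + 1 ∨ u₁.2 % 2 = 1 ∧ u₁.1 = u₂.1 + 1)) := by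
  rw [nodePos_false, nodePos_true,
    retPos_eq_callPos_add_one_iff h₂ (colRank_lt h₁) (colRank_lt h₃), Prod.ext_iff]
  unfold colRank
  split_ifs <;> omega

theorem nodePos_ret_ret_succ_iff (h₁ : u₁.1 < n) (h₂ : u₁.2 < m) (h₃ : u₂.1 < n)
    (h₄ : u₂.2 < m) :
    nodePos n m true u₂ = nodePos n m true u₁ + 1 ↔
      u₁.2 + 1 = m ∧ (u₁.2 % 2 = 0 ∧ u₁.2 = u₂.2 ∧ u₁.1 = u₂.1 + 1 ∨
        u₁.2 % 2 = 1 ∧ u₁.2 = u₂.2 ∧ u₂.1 = u₁.1 + 1) := by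
  rw [nodePos_true, nodePos_true,
    retPos_eq_retPos_add_one_iff h₂ h₄ (colRank_lt h₁) (colRank_lt h₃)]
  unfold colRank
  split_ifs <;> omega

theorem nodePos_call_call_add_two_iff (hj : u₁.2 % 2 = u₂.2 % 2) (h₁ : u₁.1 < n)
    (h₃ : u₂.1 < n) :
    nodePos n m false u₂ = nodePos n m false u₁ + 2 ↔
      u₁.2 = u₂.2 ∧ (u₁.2 = 0 ∧ u₂.1 = u₁.1 + 2 ∨
        u₁.2 ≠ 0 ∧ (u₁.2 % 2 = 0 ∧ u₂.1 = u₁.1 + 1 ∨ u₁.2 % 2 = 1 ∧ u₁.1 = u₂.1 + 1)) := by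
  rw [nodePos_false, nodePos_false,
    callPos_eq_callPos_add_two_iff hj (colRank_lt h₁) (colRank_lt h₃)]
  unfold colRank
  split_ifs <;> omega

end Positions

section Formulas

/-- The conjunction of two grid formulas. -/
def GF.and (φ ψ : GF) : GF := .not (.or (.not φ) (.not ψ))

/-- The unsatisfiable grid formula. -/
def GF.false : GF := .not (.eq 0 0)

/-- The grid formula stating that node `0` lies in the first column. -/
def GF.firstCol : GF := .not (.ex 2 (.s2 2 0))

/-- The grid formula stating that node `0` lies in the last column. -/
def GF.lastCol : GF := .not (.ex 2 (.s2 0 2))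

/-- The grid formula stating that node `0` lies in the first row. -/
def GF.firstRow : GF := .not (.ex 2 (.s1 2 0))

/-- The grid formula stating that node `0` lies in the last row. -/
def GF.lastRow : GF := .not (.ex 2 (.s1 0 2))

variable {n m : ℕ} {ν : ℕ → ℕ × ℕ}

theorem gSat_and (φ ψ : GF) : GSat n m (φ.and ψ) ν ↔ GSat n m φ ν ∧ GSat n m ψ ν := by
  simp [GF.and, GSat]

theorem gSat_or (φ ψ : GF) : GSat n m (φ.or ψ) ν ↔ GSat n m φ ν ∨ GSat n m ψ ν := Iff.rfl

theorem not_gSat_false : ¬ GSat n m .false ν := by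
  simp [GF.false, GSat]

theorem gSat_firstCol (h₁ : (ν 0).1 < n) (h₂ : (ν 0).2 < m) :
    GSat n m .firstCol ν ↔ (ν 0).2 = 0 := by
  simp only [GF.firstCol, GSat, Function.update_self,
    Function.update_of_ne (show (0 : ℕ) ≠ 2 by decide)]
  constructor
  · intro h
    by_contra h'
    exact h ⟨((ν 0).1, (ν 0).2 - 1), h₁, by dsimp only; omega, by dsimp only; omega, rfl, h₂⟩
  · rintro h ⟨p, -, -, hp, -⟩
    omega

theorem gSat_lastCol (h₁ : (ν 0).1 < n) (h₂ : (ν 0).2 < m) :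
    GSat n m .lastCol ν ↔ (ν 0).2 + 1 = m := by
  simp only [GF.lastCol, GSat, Function.update_self,
    Function.update_of_ne (show (0 : ℕ) ≠ 2 by decide)]
  constructor
  · intro h
    by_contra h'
    have hlt : (ν 0).2 + 1 < m := by omega
    exact h ⟨((ν 0).1, (ν 0).2 + 1), h₁, hlt, rfl, rfl, hlt⟩
  · rintro h ⟨p, -, -, hp, -, hlt⟩
    omega

theorem gSat_firstRow (h₁ : (ν 0).1 < n) (h₂ : (ν 0).2 < m) :
    GSat n m .firstRow ν ↔ (ν 0).1 = 0 := by
  simp only [GF.firstRow, GSat, Function.update_self,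
    Function.update_of_ne (show (0 : ℕ) ≠ 2 by decide)]
  constructor
  · intro h
    by_contra h'
    exact h ⟨((ν 0).1 - 1, (ν 0).2), by dsimp only; omega, h₂, by dsimp only; omega, rfl, h₁⟩
  · rintro h ⟨p, -, -, hp, -⟩
    omega

theorem gSat_lastRow (h₁ : (ν 0).1 < n) (h₂ : (ν 0).2 < m) :
    GSat n m .lastRow ν ↔ (ν 0).1 + 1 = n := by
  simp only [GF.lastRow, GSat, Function.update_self,
    Function.update_of_ne (show (0 : ℕ) ≠ 2 by decide)]
  constructor
  · intro h
    by_contra h'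
    have hlt : (ν 0).1 + 1 < n := by omega
    exact h ⟨((ν 0).1 + 1, (ν 0).2), hlt, h₂, rfl, rfl, hlt⟩
  · rintro h ⟨p, -, -, hp, -, hlt⟩
    omega

/-- The grid formula stating that node `1` is one row below and one column left of node `0`. -/
def GF.nextRowPrevCol : GF := .ex 2 (.and (.s2 2 0) (.s1 2 1))

/-- The grid formula stating that node `1` is one row above and one column left of node `0`. -/
def GF.prevRowPrevCol : GF := .ex 2 (.and (.s2 2 0) (.s1 1 2))

theorem gSat_nextRowPrevCol (h₁ : (ν 0).1 < n) (h₂ : (ν 0).2 < m) (h₃ : (ν 1).1 < n)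
    (h₄ : (ν 1).2 < m) :
    GSat n m .nextRowPrevCol ν ↔ (ν 0).2 = (ν 1).2 + 1 ∧ (ν 1).1 = (ν 0).1 + 1 := by
  simp only [GF.nextRowPrevCol, GSat, gSat_and, Function.update_self,
    Function.update_of_ne (show (0 : ℕ) ≠ 2 by decide),
    Function.update_of_ne (show (1 : ℕ) ≠ 2 by decide)]
  constructor
  · rintro ⟨p, -, -, hp⟩
    omega
  · rintro ⟨hc, hr⟩
    exact ⟨((ν 0).1, (ν 1).2), h₁, h₄, ⟨hc, rfl, h₂⟩, hr, rfl, h₃⟩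

theorem gSat_prevRowPrevCol (h₁ : (ν 0).1 < n) (h₂ : (ν 0).2 < m) (h₄ : (ν 1).2 < m) :
    GSat n m .prevRowPrevCol ν ↔ (ν 0).2 = (ν 1).2 + 1 ∧ (ν 0).1 = (ν 1).1 + 1 := by
  simp only [GF.prevRowPrevCol, GSat, gSat_and, Function.update_self,
    Function.update_of_ne (show (0 : ℕ) ≠ 2 by decide),
    Function.update_of_ne (show (1 : ℕ) ≠ 2 by decide)]
  constructor
  · rintro ⟨p, -, -, hp⟩
    omega
  · rintro ⟨hc, hr⟩
    exact ⟨((ν 0).1, (ν 1).2), h₁, h₄, ⟨hc, rfl, h₂⟩, hr, rfl, h₁⟩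

/-- The grid formula defining the preimage of the label predicate of a letter on the calls
(`false`) or returns (`true`). -/
def labelFormula : L2 → Bool → GF
  | .a, false => .pa 0
  | .b, false => .pb 0
  | .abar, true => .pa 0
  | .bbar, true => .pb 0
  | _, _ => .false

theorem gSat_labelFormula (c : L2) (κ : Bool) :
    GSat n m (labelFormula c κ) ν ↔ nodeLetter κ (ν 0).2 = c := by
  have := Nat.mod_two_eq_zero_or_one (ν 0).2
  cases c <;> cases κ <;>
    simp only [labelFormula, GSat, not_gSat_false, nodeLetter, callLetter, retLetter] <;>
    rcases this with h | h <;> simp [h]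

/-- The grid formula defining the preimage of the successor relation of nested words, for each
choice of copies. -/
def succFormula : Bool → Bool → GF
  | false, false => .and (.s1 0 1) .firstCol
  | false, true =>
    .or (.and (.eq 0 1) (.or (.and (.pa 0) .lastRow) (.and (.pb 0) .firstRow)))
      (.or (.and (.pa 0) .nextRowPrevCol) (.and (.pb 0) .prevRowPrevCol))
  | true, false => .s2 0 1
  | true, true => .and .lastCol (.or (.and (.pa 0) (.s1 1 0)) (.and (.pb 0) (.s1 0 1)))

theorem gSat_succFormula (κ₁ κ₂ : Bool) (h₁ : (ν 0).1 < n) (h₂ : (ν 0).2 < m)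
    (h₃ : (ν 1).1 < n) (h₄ : (ν 1).2 < m) :
    GSat n m (succFormula κ₁ κ₂) ν ↔ nodePos n m κ₂ (ν 1) = nodePos n m κ₁ (ν 0) + 1 := by
  cases κ₁ <;> cases κ₂
  · rw [nodePos_call_call_succ_iff h₁ h₃]
    simp only [succFormula, gSat_and, gSat_firstCol h₁ h₂, GSat]
    omega
  · rw [nodePos_call_ret_succ_iff h₁ h₂ h₃]
    simp only [succFormula, gSat_and, gSat_or, gSat_lastRow h₁ h₂, gSat_firstRow h₁ h₂,
      gSat_nextRowPrevCol h₁ h₂ h₃ h₄, gSat_prevRowPrevCol h₁ h₂ h₄, GSat]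
    tauto
  · rw [nodePos_ret_call_succ_iff h₁ h₃ h₄]
    simp only [succFormula, GSat]
    omega
  · rw [nodePos_ret_ret_succ_iff h₁ h₂ h₃ h₄]
    simp only [succFormula, gSat_and, gSat_lastCol h₁ h₂, GSat]
    omega

/-- The grid formula defining the preimage of the matching relation, for each choice of
copies. -/
def muFormula : Bool → Bool → GF
  | false, true => .eq 0 1
  | _, _ => .false

theorem gSat_muFormula (κ₁ κ₂ : Bool) :
    GSat n m (muFormula κ₁ κ₂) ν ↔ κ₁ = false ∧ κ₂ = true ∧ ν 0 = ν 1 := by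
  cases κ₁ <;> cases κ₂ <;> simp [muFormula, GSat, not_gSat_false]

/-- The conjunction of two formulas over nested words. -/
def MSO.and {A : Type} (φ ψ : MSO A) : MSO A := .not (.or (.not φ) (.not ψ))

theorem firstOrder_and {A : Type} {φ ψ : MSO A} :
    FirstOrder (φ.and ψ) ↔ FirstOrder φ ∧ FirstOrder ψ := Iff.rfl

theorem sat_and {K : ℕ} {A : Type} (h : CRAlphabet K A) (w : List A) (φ ψ : MSO A)
    (ν : ℕ → ℕ) (μv : ℕ → Set ℕ) :
    Sat h w (φ.and ψ) ν μv ↔ Sat h w φ ν μv ∧ Sat h w ψ ν μv := by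
  simp [MSO.and, Sat]

theorem nodeLetter_false_eq_a_iff (j : ℕ) : nodeLetter false j = .a ↔ j % 2 = 0 := by
  simp [nodeLetter, callLetter]

theorem nodeLetter_false_eq_b_iff (j : ℕ) : nodeLetter false j = .b ↔ j % 2 = 1 := by
  simp [nodeLetter, callLetter]

variable {u₁ u₂ : ℕ × ℕ}

/-- The nested-word formula defining the image of `succ₂` on call positions. -/
def succTwoFormula : MSO L2 := .ex1 2 (.and (.mu 0 2) (.succ 2 1))

theorem sat_succTwoFormula (h₁ : u₁.1 < n) (h₂ : u₁.2 < m) (h₃ : u₂.1 < n) (h₄ : u₂.2 < m)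
    (μv : ℕ → Set ℕ) :
    Sat h2 (encodeGrid n m) succTwoFormula
      (fun t => if t = 0 then nodePos n m false u₁ else nodePos n m false u₂) μv ↔
      u₂.2 = u₁.2 + 1 ∧ u₂.1 = u₁.1 := by
  have hmu : MuAny h2 (encodeGrid n m) (nodePos n m false u₁) (nodePos n m true u₁) :=
    (muAny_nodePos_iff h₁ h₂ h₁ h₂).mpr ⟨rfl, rfl, rfl⟩
  rw [← nodePos_ret_call_succ_iff h₁ h₃ h₄]
  simp only [succTwoFormula, Sat, sat_and, Function.update_self,
    Function.update_of_ne (show (0 : ℕ) ≠ 2 by decide),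
    Function.update_of_ne (show (1 : ℕ) ≠ 2 by decide), if_true, one_ne_zero, if_false]
  constructor
  · rintro ⟨i, -, hi, hs, -⟩
    rw [hs, hi.unique hmu]
  · intro h
    exact ⟨_, nodePos_lt true h₁ h₂, hmu, h, nodePos_lt false h₃ h₄⟩

/-- The nested-word formula defining the image of `succ₁` on call positions. -/
def succOneFormula : MSO L2 :=
  .or (.and (.and (.lab .a 0) (.lab .a 1))
      (.or (.succ 0 1) (.ex1 2 (.and (.not (.lab .a 2)) (.and (.succ 0 2) (.succ 2 1))))))
    (.and (.and (.lab .b 0) (.lab .b 1)) (.ex1 2 (.and (.succ 1 2) (.succ 2 0))))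

theorem getElem?_nodePos_add_one_eq_a_iff (h₁ : u₁.1 < n) (h₂ : u₁.2 < m)
    (h₃ : u₂.1 < n) (h₄ : u₂.2 < m) (hj : u₁.2 % 2 = 0) (hj' : u₂.2 % 2 = 0)
    (h : nodePos n m false u₂ = nodePos n m false u₁ + 2) :
    (encodeGrid n m)[nodePos n m false u₁ + 1]? = some .a ↔ u₁.2 = 0 := by
  obtain ⟨hc, h⟩ := (nodePos_call_call_add_two_iff (hj.trans hj'.symm) h₁ h₃).mp h
  rcases h with ⟨h0, hr⟩ | ⟨h0, h⟩
  · have hs : nodePos n m false (u₁.1 + 1, 0) = nodePos n m false u₁ + 1 :=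
      (nodePos_call_call_succ_iff h₁ (by dsimp only; omega)).mpr ⟨h0, rfl, rfl⟩
    rw [← hs, getElem?_nodePos false (by dsimp only; omega) (by dsimp only; omega)]
    simp [nodeLetter, callLetter, h0]
  · have hs : nodePos n m true (u₁.1 + 1, u₁.2 - 1) = nodePos n m false u₁ + 1 :=
      (nodePos_call_ret_succ_iff h₁ h₂ (by dsimp only; omega)).mpr
        (Or.inr ⟨by dsimp only; omega, Or.inl ⟨hj, rfl⟩⟩)
    rw [← hs, getElem?_nodePos true (by dsimp only; omega) (by dsimp only; omega)]
    simp [nodeLetter, retLetter, h0]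
    split_ifs <;> simp

theorem sat_succOneFormula (h₁ : u₁.1 < n) (h₂ : u₁.2 < m) (h₃ : u₂.1 < n) (h₄ : u₂.2 < m)
    (μv : ℕ → Set ℕ) :
    Sat h2 (encodeGrid n m) succOneFormula
      (fun t => if t = 0 then nodePos n m false u₁ else nodePos n m false u₂) μv ↔
      u₂.1 = u₁.1 + 1 ∧ u₂.2 = u₁.2 := by
  have hlen₁ := nodePos_lt false h₁ h₂
  have hlen₂ := nodePos_lt false h₃ h₄
  simp only [succOneFormula, Sat, sat_and, Function.update_self,
    Function.update_of_ne (show (0 : ℕ) ≠ 2 by decide),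
    Function.update_of_ne (show (1 : ℕ) ≠ 2 by decide), if_true, one_ne_zero, if_false,
    getElem?_nodePos _ h₁ h₂, getElem?_nodePos _ h₃ h₄, Option.some_inj,
    nodeLetter_false_eq_a_iff, nodeLetter_false_eq_b_iff]
  constructor
  · rintro (⟨⟨hj, hj'⟩, h | ⟨i, -, hi, ⟨rfl, -⟩, h, -⟩⟩ | ⟨⟨hj, hj'⟩, i, -, ⟨rfl, -⟩, h, -⟩)
    · have := (nodePos_call_call_succ_iff h₁ h₃).mp h.1
      omega
    · rw [getElem?_nodePos_add_one_eq_a_iff h₁ h₂ h₃ h₄ hj hj' h] at hi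
      have := (nodePos_call_call_add_two_iff (hj.trans hj'.symm) h₁ h₃).mp h
      omega
    · have := (nodePos_call_call_add_two_iff (hj'.trans hj.symm) h₃ h₁).mp h
      omega
  · rintro ⟨hr, hc⟩
    rcases Nat.mod_two_eq_zero_or_one u₁.2 with hj | hj
    · have hj' : u₂.2 % 2 = 0 := by omega
      refine Or.inl ⟨⟨hj, hj'⟩, ?_⟩
      by_cases h0 : u₁.2 = 0
      · exact Or.inl ⟨(nodePos_call_call_succ_iff h₁ h₃).mpr (by omega), hlen₂⟩
      · have h := (nodePos_call_call_add_two_iff (m := m) (hj.trans hj'.symm) h₁ h₃).mpr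
          (by omega)
        refine Or.inr ⟨_, by omega, ?_, ⟨rfl, by omega⟩, h, hlen₂⟩
        rwa [getElem?_nodePos_add_one_eq_a_iff h₁ h₂ h₃ h₄ hj hj' h]
    · have hj' : u₂.2 % 2 = 1 := by omega
      have h := (nodePos_call_call_add_two_iff (m := m) (hj'.trans hj.symm) h₃ h₁).mpr
        (by omega)
      exact Or.inr ⟨⟨hj, hj'⟩, _, by omega, ⟨rfl, by omega⟩, h, hlen₁⟩

end Formulas

/-- the grid-to-nested-word encoding is a strong first-order
reduction of rank 2: `Φ = encodeGrid` is injective; there are bijections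
`χ n m` from two copies (`false`: calls, `true`: returns) of the grid nodes
onto the positions of `Φ(G(n,m))` such that the pairing formula
`ψ(x₁,x₂) = μ(x₁,x₂)` identifies exactly the two copies of each grid node;
the preimages under `χ` of the label predicates, of `⋖` and of `μ` are
first-order definable over the grid signature; and the images on first
copies of `succ₁`, `succ₂`, `P_a`, `P_b` are first-order definable over the
nested-word signature. -/
theorem stmt16 :
    (∀ n m n' m', 0 < n → 0 < m → 0 < n' → 0 < m' →
      encodeGrid n m = encodeGrid n' m' → n = n' ∧ m = m') ∧
    ∃ χ : ℕ → ℕ → Bool → ℕ × ℕ → ℕ,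
      -- (1): the universe of Φ(G(n,m)) is in bijection with two copies of [n]×[m]
      (∀ n m, 0 < n → 0 < m →
        Set.BijOn (fun p : Bool × (ℕ × ℕ) => χ n m p.1 p.2)
          ((Set.univ : Set Bool) ×ˢ (Set.Iio n ×ˢ Set.Iio m))
          (Set.Iio (encodeGrid n m).length)) ∧
      -- (2): the pairing formula ψ(x₁,x₂) = μ(x₁,x₂) relates exactly the two
      -- copies of one and the same grid node
      (∀ n m, 0 < n → 0 < m → ∀ (k₁ k₂ : Bool) (u₁ u₂ : ℕ × ℕ),
        u₁.1 < n → u₁.2 < m → u₂.1 < n → u₂.2 < m →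
        (MuAny h2 (encodeGrid n m) (χ n m k₁ u₁) (χ n m k₂ u₂) ↔
          (k₁ = false ∧ k₂ = true ∧ u₁ = u₂))) ∧
      -- (3): preimages of the label predicates λ_c are grid-FO-definable
      (∀ (c : L2) (κ : Bool), ∃ φ : GF,
        ∀ n m, 0 < n → 0 < m → ∀ u : ℕ × ℕ, u.1 < n → u.2 < m →
          (GSat n m φ (fun _ => u) ↔
            (encodeGrid n m)[(χ n m κ u)]? = some c)) ∧
      -- (3): preimages of the successor relation ⋖ are grid-FO-definable
      (∀ κ₁ κ₂ : Bool, ∃ φ : GF,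
        ∀ n m, 0 < n → 0 < m → ∀ u₁ u₂ : ℕ × ℕ,
          u₁.1 < n → u₁.2 < m → u₂.1 < n → u₂.2 < m →
          (GSat n m φ (fun t => if t = 0 then u₁ else u₂) ↔
            (χ n m κ₂ u₂ = χ n m κ₁ u₁ + 1 ∧
              χ n m κ₂ u₂ < (encodeGrid n m).length))) ∧
      -- (3): preimages of the matching relation μ are grid-FO-definable
      (∀ κ₁ κ₂ : Bool, ∃ φ : GF,
        ∀ n m, 0 < n → 0 < m → ∀ u₁ u₂ : ℕ × ℕ,
          u₁.1 < n → u₁.2 < m → u₂.1 < n → u₂.2 < m →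
          (GSat n m φ (fun t => if t = 0 then u₁ else u₂) ↔
            MuAny h2 (encodeGrid n m) (χ n m κ₁ u₁) (χ n m κ₂ u₂))) ∧
      -- (4): the image of succ₁ on first copies is FO-definable over nested words
      (∃ φ : MSO L2, FirstOrder φ ∧
        ∀ n m, 0 < n → 0 < m → ∀ u₁ u₂ : ℕ × ℕ,
          u₁.1 < n → u₁.2 < m → u₂.1 < n → u₂.2 < m →
          ((u₂.1 = u₁.1 + 1 ∧ u₂.2 = u₁.2) ↔
            Sat h2 (encodeGrid n m) φ
              (fun t => if t = 0 then χ n m false u₁ else χ n m false u₂)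
              (fun _ => ∅))) ∧
      -- (4): the image of succ₂ on first copies is FO-definable
      (∃ φ : MSO L2, FirstOrder φ ∧
        ∀ n m, 0 < n → 0 < m → ∀ u₁ u₂ : ℕ × ℕ,
          u₁.1 < n → u₁.2 < m → u₂.1 < n → u₂.2 < m →
          ((u₂.2 = u₁.2 + 1 ∧ u₂.1 = u₁.1) ↔
            Sat h2 (encodeGrid n m) φ
              (fun t => if t = 0 then χ n m false u₁ else χ n m false u₂)
              (fun _ => ∅))) ∧
      -- (4): the images of P_a and P_b on first copies are FO-definable
      (∃ φ : MSO L2, FirstOrder φ ∧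
        ∀ n m, 0 < n → 0 < m → ∀ u : ℕ × ℕ, u.1 < n → u.2 < m →
          (u.2 % 2 = 0 ↔
            Sat h2 (encodeGrid n m) φ (fun _ => χ n m false u) (fun _ => ∅))) ∧
      (∃ φ : MSO L2, FirstOrder φ ∧
        ∀ n m, 0 < n → 0 < m → ∀ u : ℕ × ℕ, u.1 < n → u.2 < m →
          (u.2 % 2 = 1 ↔
            Sat h2 (encodeGrid n m) φ (fun _ => χ n m false u) (fun _ => ∅))) := by
  refine ⟨fun n m n' m' hn hm hn' hm' h => encodeGrid_injective hn hm hn' hm' h, nodePos,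
    fun n m _ hm => bijOn_nodePos n hm,
    fun n m _ _ κ₁ κ₂ u₁ u₂ h₁ h₂ h₃ h₄ => muAny_nodePos_iff h₁ h₂ h₃ h₄,
    fun c κ => ⟨labelFormula c κ, fun n m _ _ u h₁ h₂ => ?_⟩,
    fun κ₁ κ₂ => ⟨succFormula κ₁ κ₂, fun n m _ _ u₁ u₂ h₁ h₂ h₃ h₄ => ?_⟩,
    fun κ₁ κ₂ => ⟨muFormula κ₁ κ₂, fun n m _ _ u₁ u₂ h₁ h₂ h₃ h₄ => ?_⟩,
    ⟨succOneFormula, by simp [succOneFormula, firstOrder_and, FirstOrder],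
      fun n m _ _ u₁ u₂ h₁ h₂ h₃ h₄ => (sat_succOneFormula h₁ h₂ h₃ h₄ _).symm⟩,
    ⟨succTwoFormula, by simp [succTwoFormula, firstOrder_and, FirstOrder],
      fun n m _ _ u₁ u₂ h₁ h₂ h₃ h₄ => (sat_succTwoFormula h₁ h₂ h₃ h₄ _).symm⟩,
    ⟨.lab .a 0, trivial, fun n m _ _ u h₁ h₂ => ?_⟩,
    ⟨.lab .b 0, trivial, fun n m _ _ u h₁ h₂ => ?_⟩⟩
  · rw [gSat_labelFormula, getElem?_nodePos κ h₁ h₂, Option.some_inj]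
  · rw [gSat_succFormula κ₁ κ₂ (by simpa) (by simpa) (by simpa) (by simpa)]
    simpa using fun _ => nodePos_lt κ₂ h₃ h₄
  · rw [gSat_muFormula, muAny_nodePos_iff h₁ h₂ h₃ h₄]
    simp
  · simp only [Sat, getElem?_nodePos false h₁ h₂, Option.some_inj, nodeLetter_false_eq_a_iff]
  · simp only [Sat, getElem?_nodePos false h₁ h₂, Option.some_inj, nodeLetter_false_eq_b_iff]
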